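/- arXiv:1608.03043 — 2 statements merged into one kernel-verified Lean document; each statement's English description precedes it below -/
import Mathlib

section
/- Let ⟨X,d⟩ and ⟨Y,ρ⟩ be metric spaces, let ⟨f_λ⟩_{λ∈Λ} be a net of continuous functions from X to Y and ⟨A_λ⟩_{λ∈Λ} a net of nonempty subsets of X over a directed set Λ. Suppose: (a) for every open set V of X with A ⊆ V, eventually A_λ ⊆ V; (b) for every locally finite family 𝒱 of open subsets of X such that A intersects every member of 𝒱, eventually A_λ intersects every member of 𝒱; and (c) ⟨f_λ⟩ is very strongly uniformly convergent on A to a continuous function f : X → Y. Then Ω(f,A) = lim_{λ∈Λ} Ω(f_λ,A_λ) in [0,∞]. -/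
open Metric Filter ENNReal Topology

/-- The `ε`-enlargement `S_d(A,ε) = ⋃_{a ∈ A} S_d(a,ε)` of a set `A`. -/
def SEnl {X : Type*} [MetricSpace X] (A : Set X) (ε : ℝ) : Set X :=
  ⋃ a ∈ A, Metric.ball a ε

/-- `Ω_n(f,A) = sup {ρ(f x, f w) : x, w ∈ S_d(A,1/n), d(x,w) < 1/n}` in `[0,∞]`. -/
noncomputable def OmegaN {X Y : Type*} [MetricSpace X] [MetricSpace Y]
    (f : X → Y) (A : Set X) (n : ℕ) : ℝ≥0∞ :=
  ⨆ (x ∈ SEnl A (1 / (n : ℝ))) (w ∈ SEnl A (1 / (n : ℝ))) (_ : dist x w < 1 / (n : ℝ)),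
    edist (f x) (f w)

/-- The oscillation `Ω(f,A) = inf_{n ≥ 1} Ω_n(f,A)` of `f` at `A`. -/
noncomputable def Omega {X Y : Type*} [MetricSpace X] [MetricSpace Y]
    (f : X → Y) (A : Set X) : ℝ≥0∞ :=
  ⨅ n : ℕ, OmegaN f A (n + 1)

/-- A net `⟨f_λ⟩` is very strongly uniformly convergent to `f` on `A` if for each `ε > 0`
there exist `λ₀` and `δ > 0` such that for all `λ ⪰ λ₀` and all `x ∈ S_d(A,δ)`,
`ρ(f_λ(x), f(x)) < ε`. -/
def VeryStronglyUniformlyConvergentOn {X Y Λ : Type*} [MetricSpace X] [MetricSpace Y]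
    [Preorder Λ] (F : Λ → X → Y) (f : X → Y) (A : Set X) : Prop :=
  ∀ ε : ℝ, 0 < ε → ∃ l₀ : Λ, ∃ δ : ℝ, 0 < δ ∧
    ∀ l : Λ, l₀ ≤ l → ∀ x ∈ SEnl A δ, dist (F l x) (f x) < ε

theorem mem_sEnl {X : Type*} [MetricSpace X] {A : Set X} {ε : ℝ} {x : X} :
    x ∈ SEnl A ε ↔ ∃ a ∈ A, dist x a < ε := by
  simp [SEnl]

theorem isOpen_sEnl {X : Type*} [MetricSpace X] (A : Set X) (ε : ℝ) : IsOpen (SEnl A ε) :=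
  isOpen_biUnion fun _ _ => Metric.isOpen_ball

theorem subset_sEnl {X : Type*} [MetricSpace X] (A : Set X) {ε : ℝ} (hε : 0 < ε) :
    A ⊆ SEnl A ε := fun a ha => mem_sEnl.2 ⟨a, ha, by simpa using hε⟩

theorem mem_sEnl_mono {X : Type*} [MetricSpace X] {A : Set X} {ε δ : ℝ} (h : ε ≤ δ) {x : X}
    (hx : x ∈ SEnl A ε) : x ∈ SEnl A δ := by
  obtain ⟨a, ha, hxa⟩ := mem_sEnl.1 hx
  exact mem_sEnl.2 ⟨a, ha, hxa.trans_le h⟩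

theorem mem_sEnl_add {X : Type*} [MetricSpace X] {A B : Set X} {ε δ : ℝ} (h : B ⊆ SEnl A δ)
    {x : X} (hx : x ∈ SEnl B ε) : x ∈ SEnl A (ε + δ) := by
  obtain ⟨b, hb, hxb⟩ := mem_sEnl.1 hx
  obtain ⟨a, ha, hba⟩ := mem_sEnl.1 (h hb)
  exact mem_sEnl.2 ⟨a, ha, (dist_triangle x b a).trans_lt (add_lt_add hxb hba)⟩

theorem omega_le_omegaN {X Y : Type*} [MetricSpace X] [MetricSpace Y] (f : X → Y) (A : Set X)
    (n : ℕ) : Omega f A ≤ OmegaN f A (n + 1) :=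
  iInf_le (fun n : ℕ => OmegaN f A (n + 1)) n

theorem edist_le_omegaN {X Y : Type*} [MetricSpace X] [MetricSpace Y] (f : X → Y) {A : Set X}
    {n : ℕ} {x w : X} (hx : x ∈ SEnl A (1 / (n : ℝ))) (hw : w ∈ SEnl A (1 / (n : ℝ)))
    (hxw : dist x w < 1 / (n : ℝ)) : edist (f x) (f w) ≤ OmegaN f A n :=
  le_iSup₂_of_le x hx (le_iSup₂_of_le w hw (le_iSup_of_le hxw le_rfl))

theorem omegaN_le_iff {X Y : Type*} [MetricSpace X] [MetricSpace Y] {f : X → Y} {A : Set X}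
    {n : ℕ} {c : ℝ≥0∞} : OmegaN f A n ≤ c ↔
      ∀ x ∈ SEnl A (1 / (n : ℝ)), ∀ w ∈ SEnl A (1 / (n : ℝ)), dist x w < 1 / (n : ℝ) →
        edist (f x) (f w) ≤ c := by
  simp only [OmegaN, iSup_le_iff]

theorem exists_lt_edist_of_lt_omegaN {X Y : Type*} [MetricSpace X] [MetricSpace Y] {f : X → Y}
    {A : Set X} {n : ℕ} {c : ℝ≥0∞} (h : c < OmegaN f A n) :
    ∃ x ∈ SEnl A (1 / (n : ℝ)), ∃ w ∈ SEnl A (1 / (n : ℝ)),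
      dist x w < 1 / (n : ℝ) ∧ c < edist (f x) (f w) := by
  contrapose! h
  exact omegaN_le_iff.2 h

theorem edist_le_edist_add_of_dist_lt {Y : Type*} [MetricSpace Y] {a b a' b' : Y} {r : NNReal}
    (ha : dist a a' < r / 2) (hb : dist b b' < r / 2) : edist a b ≤ edist a' b' + r := by
  have h : dist a b ≤ dist a' b' + r := by
    have := dist_triangle4 a a' b' b
    rw [dist_comm b' b] at this
    linarith
  rw [edist_nndist, edist_nndist]
  exact_mod_cast h

/-- Continuity of `f` prevents balls about points near large jumps of `f` from accumulating. -/
theorem locallyFinite_ball_of_lt_edist {X Y : Type*} [MetricSpace X] [MetricSpace Y] {f : X → Y}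
    (hf : Continuous f) {a x w : ℕ → X} {r : NNReal} (hr : 0 < r)
    (hxa : ∀ n : ℕ, dist (x n) (a n) < 1 / ((n : ℝ) + 1))
    (hxw : ∀ n : ℕ, dist (x n) (w n) < 1 / ((n : ℝ) + 1))
    (hfxw : ∀ n, (r : ℝ≥0∞) < edist (f (x n)) (f (w n))) :
    LocallyFinite fun n : ℕ => Metric.ball (a n) (1 / ((n : ℝ) + 1)) := by
  intro p
  obtain ⟨η, hη, hfη⟩ := Metric.continuous_iff.1 hf p (r / 2) (by positivity)
  obtain ⟨N, hN⟩ := exists_nat_one_div_lt (show 0 < η / 4 by positivity)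
  refine ⟨Metric.ball p (η / 4), Metric.ball_mem_nhds p (by positivity),
    (Set.finite_lt_nat N).subset ?_⟩
  rintro n ⟨y, hya, hyp⟩
  rw [Metric.mem_ball] at hya hyp
  by_contra hn
  have hNn : 1 / ((n : ℝ) + 1) ≤ 1 / ((N : ℝ) + 1) := Nat.one_div_le_one_div (not_lt.1 hn)
  have hxp : dist (x n) p < 3 * (η / 4) := by
    have := dist_triangle4 (x n) (a n) y p
    rw [dist_comm (a n) y] at this
    linarith [hxa n]
  have hwp : dist (w n) p < η := by
    have := dist_triangle_left (w n) p (x n)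
    linarith [hxw n]
  have h := edist_le_edist_add_of_dist_lt (hfη (x n) (by linarith)) (hfη (w n) hwp)
  rw [edist_self, zero_add] at h
  exact (hfxw n).not_ge h

theorem eventually_omega_lt {X Y Λ : Type*} [MetricSpace X] [MetricSpace Y] [Preorder Λ]
    {F : Λ → X → Y} {A : Λ → Set X} {f : X → Y} {A₀ : Set X}
    (ha : ∀ V : Set X, IsOpen V → A₀ ⊆ V → ∀ᶠ l in atTop, A l ⊆ V)
    (hc : VeryStronglyUniformlyConvergentOn F f A₀) {c : ℝ≥0∞} (h : Omega f A₀ < c) :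
    ∀ᶠ l in atTop, Omega (F l) (A l) < c := by
  obtain ⟨n, hn⟩ := iInf_lt_iff.1 h
  obtain ⟨r, hr, hrc⟩ := ENNReal.lt_iff_exists_add_pos_lt.1 hn
  obtain ⟨l₀, δ, hδ, hFf⟩ := hc (r / 2) (by positivity)
  have hn0 : 0 < 1 / ((n + 1 : ℕ) : ℝ) := by positivity
  obtain ⟨m, hm⟩ := exists_nat_one_div_lt
    (show 0 < min δ (1 / ((n + 1 : ℕ) : ℝ)) / 2 by positivity)
  have hδ' := min_le_left δ (1 / ((n + 1 : ℕ) : ℝ))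
  have hn' := min_le_right δ (1 / ((n + 1 : ℕ) : ℝ))
  have hm0 : 0 < 1 / ((m : ℝ) + 1) := by positivity
  filter_upwards [eventually_ge_atTop l₀, ha _ (isOpen_sEnl A₀ _) (subset_sEnl A₀ hm0)]
    with l hl hAl
  refine ((omega_le_omegaN (F l) (A l) m).trans (omegaN_le_iff.2 fun x hx w hw hxw => ?_)).trans_lt hrc
  push_cast at hx hw hxw
  have hx' := mem_sEnl_add hAl hx
  have hw' := mem_sEnl_add hAl hw
  refine (edist_le_edist_add_of_dist_lt
    (hFf l hl x (mem_sEnl_mono (by linarith) hx'))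
    (hFf l hl w (mem_sEnl_mono (by linarith) hw'))).trans ?_
  gcongr
  exact edist_le_omegaN f (mem_sEnl_mono (by linarith) hx') (mem_sEnl_mono (by linarith) hw')
    (by linarith)

theorem eventually_lt_omega {X Y Λ : Type*} [MetricSpace X] [MetricSpace Y] [Preorder Λ]
    {F : Λ → X → Y} {A : Λ → Set X} {f : X → Y} (hf : Continuous f) {A₀ : Set X}
    (hb : ∀ 𝒱 : Set (Set X), (∀ V ∈ 𝒱, IsOpen V) →
      LocallyFinite (fun V : 𝒱 => (V : Set X)) →
      (∀ V ∈ 𝒱, (A₀ ∩ V).Nonempty) →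
      ∀ᶠ l in atTop, ∀ V ∈ 𝒱, (A l ∩ V).Nonempty)
    (hc : VeryStronglyUniformlyConvergentOn F f A₀) {c : ℝ≥0∞} (h : c < Omega f A₀) :
    ∀ᶠ l in atTop, c < Omega (F l) (A l) := by
  obtain ⟨r, hr, hrc⟩ := ENNReal.lt_iff_exists_add_pos_lt.1 h
  have hc_top : c ≠ ⊤ := h.ne_top
  choose x hx w hw hxw hfxw using fun n : ℕ =>
    exists_lt_edist_of_lt_omegaN (hrc.trans_le (omega_le_omegaN f A₀ n))
  push_cast at hx hw hxw
  choose a haA hxa using fun n => mem_sEnl.1 (hx n)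
  have hlf := locallyFinite_ball_of_lt_edist hf hr hxa hxw
    fun n => le_add_self.trans_lt (hfxw n)
  obtain ⟨l₀, δ, hδ, hFf⟩ := hc ((r / 2 : NNReal) / 2) (by positivity)
  have hmeet := hb _ (Set.forall_mem_range.2 fun n => Metric.isOpen_ball) hlf.on_range
    (Set.forall_mem_range.2 fun n => ⟨a n, haA n, Metric.mem_ball_self (by positivity)⟩)
  filter_upwards [eventually_ge_atTop l₀, hmeet] with l hl hAl
  have hlt : c < c + (r / 2 : NNReal) :=
    ENNReal.lt_add_right hc_top (by exact_mod_cast (half_pos hr).ne')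
  refine hlt.trans_le (le_iInf fun m => ?_)
  have hm0 : 0 < 1 / ((m + 1 : ℕ) : ℝ) := by positivity
  obtain ⟨n, hn⟩ := exists_nat_one_div_lt
    (show 0 < min δ (1 / ((m + 1 : ℕ) : ℝ)) / 3 by positivity)
  have hδ' := min_le_left δ (1 / ((m + 1 : ℕ) : ℝ))
  have hm' := min_le_right δ (1 / ((m + 1 : ℕ) : ℝ))
  have hn0 : 0 < 1 / ((n : ℝ) + 1) := by positivity
  obtain ⟨b, hbA, hba⟩ := hAl _ (Set.mem_range_self n)
  rw [Metric.mem_ball, dist_comm] at hba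
  have hxb : dist (x n) b < 2 * (1 / ((n : ℝ) + 1)) := by
    linarith [dist_triangle (x n) (a n) b, hxa n]
  have hwb : dist (w n) b < 3 * (1 / ((n : ℝ) + 1)) := by
    linarith [dist_triangle_left (w n) b (x n), hxw n]
  have hF : edist (F l (x n)) (F l (w n)) ≤ OmegaN (F l) (A l) (m + 1) :=
    edist_le_omegaN (F l) (mem_sEnl.2 ⟨b, hbA, by linarith⟩) (mem_sEnl.2 ⟨b, hbA, by linarith⟩)
      (by linarith [hxw n])
  have hfF : edist (f (x n)) (f (w n)) ≤ edist (F l (x n)) (F l (w n)) + (r / 2 : NNReal) := by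
    refine edist_le_edist_add_of_dist_lt ?_ ?_ <;> rw [dist_comm]
    · exact hFf l hl _ (mem_sEnl_mono (by linarith) (hx n))
    · exact hFf l hl _ (mem_sEnl_mono (by linarith) (hw n))
  refine le_trans ?_ hF
  have hsum : c + (r / 2 : NNReal) + (r / 2 : NNReal) = c + r := by
    rw [add_assoc, ← ENNReal.coe_add, add_halves]
  rw [← ENNReal.add_le_add_iff_right (ENNReal.coe_ne_top (r := r / 2)), hsum]
  exact (hfxw n).le.trans hfF

/-- If a net of continuous functions `⟨f_λ⟩` is very strongly uniformly convergent on `A`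
to a continuous `f`, and `⟨A_λ⟩` converges to `A` in the locally finite topology, then
`Ω(f_λ,A_λ) → Ω(f,A)` in `[0,∞]`. -/
theorem oscillation_tendsto_of_veryStronglyUniformlyConvergent
    {X Y Λ : Type*} [MetricSpace X] [MetricSpace Y] [Nonempty Λ] [Preorder Λ]
    (hdir : ∀ a b : Λ, ∃ c : Λ, a ≤ c ∧ b ≤ c)
    (F : Λ → X → Y) (hF : ∀ l, Continuous (F l))
    (A : Λ → Set X) (hAne : ∀ l, (A l).Nonempty)
    (f : X → Y) (hf : Continuous f)
    (A₀ : Set X) (hA₀ : A₀.Nonempty)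
    (ha : ∀ V : Set X, IsOpen V → A₀ ⊆ V → ∀ᶠ l in atTop, A l ⊆ V)
    (hb : ∀ 𝒱 : Set (Set X), (∀ V ∈ 𝒱, IsOpen V) →
      LocallyFinite (fun V : 𝒱 => (V : Set X)) →
      (∀ V ∈ 𝒱, (A₀ ∩ V).Nonempty) →
      ∀ᶠ l in atTop, ∀ V ∈ 𝒱, (A l ∩ V).Nonempty)
    (hc : VeryStronglyUniformlyConvergentOn F f A₀) :
    Tendsto (fun l => Omega (F l) (A l)) atTop (𝓝 (Omega f A₀)) := by
  exact tendsto_order.2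
    ⟨fun _ h => eventually_lt_omega hf hb hc h, fun _ h => eventually_omega_lt ha hc h⟩
end

section
/- Let ⟨X,d⟩ and ⟨Y,ρ⟩ be metric spaces, let ⟨f_λ⟩_{λ∈Λ} be a net of continuous functions from X to Y converging uniformly on X (with respect to ρ) to a continuous function f : X → Y, and let ⟨A_λ⟩_{λ∈Λ} be a net of nonempty subsets of X such that: (a) for every open set V of X with A ⊆ V, eventually A_λ ⊆ V; and (b) for every locally finite family 𝒱 of open subsets of X such that A intersects every member of 𝒱, eventually A_λ intersects every member of 𝒱, where A is a nonempty subset of X. Then lim_{λ∈Λ} Ω(f_λ,A_λ) = Ω(f,A) in [0,∞]. (That is, (f,A) ↦ Ω(f,A) is jointly continuous when C(X,Y) carries the topology of uniform convergence and the nonempty subsets of X carry the locally finite topology.) -/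
open Metric Filter ENNReal Topology

section Oscillation

variable {X Y : Type*} [MetricSpace X] [MetricSpace Y]

lemma mem_SEnl {A : Set X} {ε : ℝ} {x : X} : x ∈ SEnl A ε ↔ ∃ a ∈ A, dist x a < ε := by
  simp [SEnl]

lemma isOpen_SEnl (A : Set X) (ε : ℝ) : IsOpen (SEnl A ε) :=
  isOpen_biUnion fun _ _ => isOpen_ball

lemma subset_SEnl (A : Set X) {ε : ℝ} (hε : 0 < ε) : A ⊆ SEnl A ε :=
  fun a ha => mem_SEnl.2 ⟨a, ha, by simpa using hε⟩

lemma edist_le_OmegaN (f : X → Y) {A : Set X} {n : ℕ} {x w : X}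
    (hx : x ∈ SEnl A (1 / (n : ℝ))) (hw : w ∈ SEnl A (1 / (n : ℝ)))
    (hxw : dist x w < 1 / (n : ℝ)) : edist (f x) (f w) ≤ OmegaN f A n :=
  le_iSup₂_of_le x hx <| le_iSup₂_of_le w hw <| le_iSup_of_le hxw le_rfl

lemma OmegaN_le_iff (f : X → Y) {A : Set X} {n : ℕ} {c : ℝ≥0∞} :
    OmegaN f A n ≤ c ↔ ∀ x ∈ SEnl A (1 / (n : ℝ)), ∀ w ∈ SEnl A (1 / (n : ℝ)),
      dist x w < 1 / (n : ℝ) → edist (f x) (f w) ≤ c := by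
  simp only [OmegaN, iSup_le_iff]

lemma lt_OmegaN_iff (f : X → Y) {A : Set X} {n : ℕ} {c : ℝ≥0∞} :
    c < OmegaN f A n ↔ ∃ x ∈ SEnl A (1 / (n : ℝ)), ∃ w ∈ SEnl A (1 / (n : ℝ)),
      dist x w < 1 / (n : ℝ) ∧ c < edist (f x) (f w) := by
  simp only [OmegaN, lt_iSup_iff, exists_prop]

lemma OmegaN_le_OmegaN_add {f g : X → Y} {ε : ℝ≥0∞} (h : ∀ x, edist (f x) (g x) ≤ ε)
    (A : Set X) (n : ℕ) : OmegaN f A n ≤ OmegaN g A n + 2 * ε := by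
  refine (OmegaN_le_iff f).2 fun x hx w hw hxw => ?_
  calc edist (f x) (f w)
      ≤ edist (f x) (g x) + edist (g x) (g w) + edist (g w) (f w) := edist_triangle4 _ _ _ _
    _ ≤ ε + OmegaN g A n + ε := by
        gcongr
        · exact h x
        · exact edist_le_OmegaN g hx hw hxw
        · exact edist_comm (f w) (g w) ▸ h w
    _ = OmegaN g A n + 2 * ε := by ring

lemma Omega_le_Omega_add {f g : X → Y} {ε : ℝ≥0∞} (h : ∀ x, edist (f x) (g x) ≤ ε)
    (A : Set X) : Omega f A ≤ Omega g A + 2 * ε := by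
  rw [Omega, Omega, ENNReal.iInf_add]
  exact iInf_mono fun n => OmegaN_le_OmegaN_add h A (n + 1)

/-- If `A` is contained in a small enlargement of `B`, then its oscillation is bounded by that of
`B` at a fixed scale. -/
lemma Omega_le_OmegaN (f : X → Y) {A B : Set X} {n : ℕ}
    (h : A ⊆ SEnl B (1 / ((n + 1 : ℕ) : ℝ) / 2)) : Omega f A ≤ OmegaN f B (n + 1) := by
  have hn : (0 : ℝ) < ((n + 1 : ℕ) : ℝ) := by positivity
  have hm : 1 / ((2 * n + 1 + 1 : ℕ) : ℝ) = 1 / ((n + 1 : ℕ) : ℝ) / 2 := by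
    push_cast
    field_simp
    ring
  have hsub : SEnl A (1 / ((2 * n + 1 + 1 : ℕ) : ℝ)) ⊆ SEnl B (1 / ((n + 1 : ℕ) : ℝ)) := by
    intro x hx
    obtain ⟨a, ha, hxa⟩ := mem_SEnl.1 hx
    obtain ⟨b, hb, hab⟩ := mem_SEnl.1 (h ha)
    rw [hm] at hxa
    exact mem_SEnl.2 ⟨b, hb, by linarith [dist_triangle x a b]⟩
  refine (iInf_le _ (2 * n + 1)).trans ((OmegaN_le_iff f).2 fun x hx w hw hxw => ?_)
  refine edist_le_OmegaN f (hsub hx) (hsub hw) (hxw.trans ?_)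
  rw [hm]
  exact half_lt_self (by positivity)

/-- If the oscillation of a continuous function at `A` exceeds `c > 0`, there is a countable locally
finite family of open sets meeting `A` such that the oscillation at any set meeting all members of
the family is at least `c`. -/
lemma exists_locallyFinite_le_Omega {f : X → Y} (hf : Continuous f) {A : Set X} {c : ℝ≥0∞}
    (hc₀ : 0 < c) (hc : c < Omega f A) :
    ∃ V : ℕ → Set X, (∀ n, IsOpen (V n)) ∧ LocallyFinite V ∧ (∀ n, (A ∩ V n).Nonempty) ∧
      ∀ B : Set X, (∀ n, (B ∩ V n).Nonempty) → c ≤ Omega f B := by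
  have key : ∀ n : ℕ, ∃ x w a : X, a ∈ A ∧ dist x a < 1 / ((n + 1 : ℕ) : ℝ) ∧
      dist x w < 1 / ((n + 1 : ℕ) : ℝ) ∧ c < edist (f x) (f w) := by
    intro n
    obtain ⟨x, hx, w, -, hxw, hcxw⟩ := (lt_OmegaN_iff f).1 (hc.trans_le (iInf_le _ n))
    obtain ⟨a, ha, hxa⟩ := mem_SEnl.1 hx
    exact ⟨x, w, a, ha, hxa, hxw, hcxw⟩
  choose x w a ha hxa hxw hcxw using key
  have hpos : ∀ n : ℕ, (0 : ℝ) < 1 / ((n + 1 : ℕ) : ℝ) := fun n => by positivity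
  have hsmall : ∀ δ : ℝ, 0 < δ → ∃ N : ℕ, ∀ n ≥ N, 3 * (1 / ((n + 1 : ℕ) : ℝ)) < δ := by
    intro δ hδ
    obtain ⟨N, hN⟩ := exists_nat_one_div_lt (show 0 < δ / 3 by positivity)
    refine ⟨N, fun n hn => ?_⟩
    have : 1 / ((n + 1 : ℕ) : ℝ) ≤ 1 / ((N : ℝ) + 1) := by
      push_cast
      gcongr
    linarith
  refine ⟨fun n => ball (a n) (1 / ((n + 1 : ℕ) : ℝ)), fun n => isOpen_ball, fun p => ?_,
    fun n => ⟨a n, ha n, mem_ball_self (hpos n)⟩, fun B hB => le_iInf fun m => ?_⟩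
  · have hU : f ⁻¹' (Metric.eball (f p) (c / 2)) ∈ 𝓝 p :=
      hf.continuousAt (Metric.eball_mem_nhds _ (ENNReal.half_pos hc₀.ne'))
    obtain ⟨δ, hδ, hball⟩ := Metric.mem_nhds_iff.1 hU
    obtain ⟨N, hN⟩ := hsmall (δ / 2) (by positivity)
    refine ⟨ball p (δ / 2), ball_mem_nhds p (by positivity),
      (Set.finite_lt_nat N).subset fun n hn => ?_⟩
    obtain ⟨q, hqa, hqp⟩ := hn
    rw [mem_ball] at hqa hqp
    by_contra hnN
    have h3 := hN n (not_lt.1 hnN)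
    have hpn := hpos n
    have hxp : dist (x n) p < δ := by
      linarith [dist_triangle4 (x n) (a n) q p,
        dist_comm (a n) q, hxa n]
    have hwp : dist (w n) p < δ := by
      linarith [dist_triangle (w n) (x n) p, dist_triangle4 (x n) (a n) q p,
        dist_comm (a n) q, dist_comm (w n) (x n), hxa n, hxw n]
    have h1 : edist (f (x n)) (f p) < c / 2 := hball hxp
    have h2 : edist (f (w n)) (f p) < c / 2 := hball hwp
    refine (hcxw n).not_ge ?_
    calc edist (f (x n)) (f (w n)) ≤ edist (f (x n)) (f p) + edist (f (w n)) (f p) :=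
          edist_triangle_right _ _ _
      _ ≤ c / 2 + c / 2 := add_le_add h1.le h2.le
      _ = c := ENNReal.add_halves c
  · obtain ⟨n, hn⟩ := hsmall _ (hpos m)
    have h3 := hn n le_rfl
    have hpn := hpos n
    obtain ⟨b, hbB, hb⟩ := hB n
    rw [mem_ball] at hb
    refine (hcxw n).le.trans (edist_le_OmegaN f (mem_SEnl.2 ⟨b, hbB, ?_⟩)
      (mem_SEnl.2 ⟨b, hbB, ?_⟩) ?_)
    · linarith [dist_triangle_right (x n) b (a n), hxa n]
    · linarith [dist_triangle (w n) (x n) b, dist_triangle_right (x n) b (a n),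
        dist_comm (w n) (x n), hxa n, hxw n]
    · linarith [hxw n]

end Oscillation

/-- Joint continuity of oscillation: if a net of continuous functions converges uniformly
on `X` to a continuous `f`, and `⟨A_λ⟩` converges to the nonempty set `A` in the locally
finite topology, then `Ω(f_λ,A_λ) → Ω(f,A)` in `[0,∞]`. -/
theorem oscillation_jointly_continuous
    {X Y Λ : Type*} [MetricSpace X] [MetricSpace Y] [Nonempty Λ] [Preorder Λ]
    (hdir : ∀ a b : Λ, ∃ c : Λ, a ≤ c ∧ b ≤ c)
    (F : Λ → X → Y) (hF : ∀ l, Continuous (F l))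
    (f : X → Y) (hf : Continuous f)
    (hunif : ∀ ε : ℝ, 0 < ε → ∃ l₀ : Λ, ∀ l : Λ, l₀ ≤ l → ∀ x : X, dist (F l x) (f x) < ε)
    (A : Λ → Set X) (hAne : ∀ l, (A l).Nonempty)
    (A₀ : Set X) (hA₀ : A₀.Nonempty)
    (ha : ∀ V : Set X, IsOpen V → A₀ ⊆ V → ∀ᶠ l in atTop, A l ⊆ V)
    (hb : ∀ 𝒱 : Set (Set X), (∀ V ∈ 𝒱, IsOpen V) →
      LocallyFinite (fun V : 𝒱 => (V : Set X)) →
      (∀ V ∈ 𝒱, (A₀ ∩ V).Nonempty) →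
      ∀ᶠ l in atTop, ∀ V ∈ 𝒱, (A l ∩ V).Nonempty) :
    Tendsto (fun l => Omega (F l) (A l)) atTop (𝓝 (Omega f A₀)) := by
  have hclose : ∀ r : NNReal, 0 < r → ∀ᶠ l in atTop, ∀ x, edist (F l x) (f x) ≤ r / 2 := by
    intro r hr
    obtain ⟨l₀, h⟩ := hunif (r / 2 : NNReal) (by positivity)
    filter_upwards [eventually_ge_atTop l₀] with l hl x
    have hx : nndist (F l x) (f x) ≤ r / 2 := (h l hl x).le
    rw [edist_nndist]
    calc ((nndist (F l x) (f x) : NNReal) : ℝ≥0∞) ≤ ((r / 2 : NNReal) : ℝ≥0∞) := by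
          exact_mod_cast hx
      _ = r / 2 := by simp
  have htwo : ∀ r : ℝ≥0∞, 2 * (r / 2) = r := fun r =>
    ENNReal.mul_div_cancel two_ne_zero ofNat_ne_top
  refine tendsto_order.2 ⟨fun c hc => ?_, fun c hc => ?_⟩
  · obtain ⟨c', hcc', hc'⟩ := exists_between hc
    obtain ⟨r, hr, hcr⟩ := ENNReal.lt_iff_exists_add_pos_lt.1 hcc'
    obtain ⟨V, hVo, hVf, hVA, hV⟩ :=
      exists_locallyFinite_le_Omega hf (zero_le.trans_lt hcc') hc'
    have hhit := hb (Set.range V) (Set.forall_mem_range.2 hVo) hVf.on_range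
      (Set.forall_mem_range.2 hVA)
    filter_upwards [hhit, hclose r hr] with l hl hFl
    have h1 := hV (A l) fun n => hl _ (Set.mem_range_self n)
    have h2 := Omega_le_Omega_add (fun x => edist_comm (F l x) (f x) ▸ hFl x) (A l)
    rw [htwo] at h2
    exact lt_of_add_lt_add_right (hcr.trans_le (h1.trans h2))
  · obtain ⟨n, hn⟩ := iInf_lt_iff.1 hc
    obtain ⟨r, hr, hcr⟩ := ENNReal.lt_iff_exists_add_pos_lt.1 hn
    filter_upwards [ha _ (isOpen_SEnl A₀ (1 / ((n + 1 : ℕ) : ℝ) / 2))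
      (subset_SEnl A₀ (by positivity)), hclose r hr] with l hl hFl
    have h2 := Omega_le_Omega_add hFl (A l)
    rw [htwo] at h2
    exact (h2.trans (add_le_add_left (Omega_le_OmegaN f hl) _)).trans_lt hcr
end
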